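/- Let a = 1/2, k ≥ 1, and x ∈ (0,1). Then M_{k,1/2} has a finite derivative at x if and only if there exists n ∈ ℕ such that l_n(x) = k+1 and 3ⁿx ∉ ℤ; in that case M_{k,1/2}'(x) = 0. -/

import Mathlib

open Filter Topology MeasureTheory Set
open scoped ENNReal

/-- The `(n+1)`-th ternary digit of `x` (choosing the expansion ending in all `0`s
when two expansions exist, and the all-`2`s expansion for `x = 1`). -/
noncomputable def tDigit (x : ℝ) (n : ℕ) : ℕ :=
  if x = 1 then 2 else (⌊(3:ℝ) ^ (n + 1) * x⌋ - 3 * ⌊(3:ℝ) ^ n * x⌋).toNat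

/-- `l_n(x)`: the number of `1`s among the first `n` ternary digits of `x`. -/
noncomputable def lCount (x : ℝ) (n : ℕ) : ℕ :=
  ((Finset.range n).filter (fun i => tDigit x i = 1)).card

/-- `q_a(d)` with `q_a(0)=0`, `q_a(1)=a`, `q_a(2)=1-a`. -/
noncomputable def qDig (a : ℝ) (d : ℕ) : ℝ :=
  if d = 0 then 0 else if d = 1 then a else 1 - a

/-- Okamoto's function `F_a`. -/
noncomputable def Okamoto (a x : ℝ) : ℝ :=
  ∑' n : ℕ, a ^ (n - lCount x n) * (1 - 2 * a) ^ lCount x n * qDig a (tDigit x n)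

/-- `M_{k,a}(x)`: the `k`-th partial derivative of `F_a(x)` with respect to `a`. -/
noncomputable def Mfun (k : ℕ) (a x : ℝ) : ℝ :=
  iteratedDeriv k (fun b => Okamoto b x) a

/-- `f` has derivative `+∞` at `x` (difference quotients over `y ∈ [0,1] \ {x}`). -/
def derivPInf (f : ℝ → ℝ) (x : ℝ) : Prop :=
  Tendsto (fun y => (f y - f x) / (y - x)) (𝓝[Set.Icc 0 1 \ {x}] x) atTop

/-- `f` has derivative `-∞` at `x`. -/
def derivMInf (f : ℝ → ℝ) (x : ℝ) : Prop :=
  Tendsto (fun y => (f y - f x) / (y - x)) (𝓝[Set.Icc 0 1 \ {x}] x) atBot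

noncomputable def phiOk (a : ℝ) : ℝ :=
  if a = 1/3 then 1/3 else if a = 1/2 then 0
  else Real.log (3 * a) / (Real.log a - Real.log |1 - 2 * a|)

noncomputable def C0 (a : ℝ) : ℝ := 1 / (Real.log a - Real.log |1 - 2 * a|)

noncomputable def hEnt (p : ℝ) : ℝ :=
  (-(p * Real.log p) - (1 - p) * Real.log (1 - p) + (1 - p) * Real.log 2) / Real.log 3

noncomputable def dOk (a : ℝ) : ℝ := hEnt (phiOk a)

noncomputable def dTilde (a : ℝ) : ℝ := hEnt (1 - 2 * a)

open Finset in
lemma lCount_le (x : ℝ) (n : ℕ) : lCount x n ≤ n :=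
  (card_filter_le _ _).trans (card_range n).le

lemma lCount_succ (x : ℝ) (n : ℕ) :
    lCount x (n + 1) = lCount x n + if tDigit x n = 1 then 1 else 0 := by
  simp only [lCount, Finset.card_filter, Finset.sum_range_succ]

/-- The `n`-th term of the series defining Okamoto's function, at a complex parameter. -/
noncomputable def okamotoTerm (x : ℝ) (n : ℕ) (b : ℂ) : ℂ :=
  b ^ (n - lCount x n) * (1 - 2 * b) ^ lCount x n *
    if tDigit x n = 0 then 0 else if tDigit x n = 1 then b else 1 - b

lemma norm_okamotoTerm_le (x : ℝ) (n : ℕ) {b : ℂ} (hb : b ∈ Metric.ball (1 / 2 : ℂ) (1 / 4)) :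
    ‖okamotoTerm x n b‖ ≤ (3 / 4) ^ n := by
  rw [mem_ball_iff_norm] at hb
  have h1 : ‖b‖ ≤ 3 / 4 := by
    calc ‖b‖ = ‖(b - 1 / 2) + 1 / 2‖ := by ring_nf
      _ ≤ ‖b - 1 / 2‖ + ‖(1 / 2 : ℂ)‖ := norm_add_le _ _
      _ ≤ 3 / 4 := by norm_num at hb ⊢; linarith
  have h2 : ‖1 - b‖ ≤ 3 / 4 := by
    calc ‖1 - b‖ = ‖1 / 2 - (b - 1 / 2)‖ := by ring_nf
      _ ≤ ‖(1 / 2 : ℂ)‖ + ‖b - 1 / 2‖ := norm_sub_le _ _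
      _ ≤ 3 / 4 := by norm_num at hb ⊢; linarith
  have h3 : ‖1 - 2 * b‖ ≤ 3 / 4 := by
    calc ‖1 - 2 * b‖ = ‖(-2 : ℂ) * (b - 1 / 2)‖ := by ring_nf
      _ = 2 * ‖b - 1 / 2‖ := by simp
      _ ≤ 3 / 4 := by linarith
  rw [okamotoTerm, norm_mul, norm_mul, norm_pow, norm_pow]
  have h4 : ‖(if tDigit x n = 0 then 0 else if tDigit x n = 1 then b else 1 - b : ℂ)‖ ≤ 1 := by
    split_ifs
    · simp
    · linarith
    · linarith
  calc _ ≤ (3 / 4 : ℝ) ^ (n - lCount x n) * (3 / 4) ^ lCount x n * 1 := by gcongr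
    _ = (3 / 4) ^ n := by rw [mul_one, pow_sub_mul_pow _ (lCount_le x n)]

lemma ofReal_term_eq (x : ℝ) (n : ℕ) (b : ℝ) :
    ((b ^ (n - lCount x n) * (1 - 2 * b) ^ lCount x n * qDig b (tDigit x n) : ℝ) : ℂ) =
      okamotoTerm x n b := by
  rw [okamotoTerm, qDig]
  split_ifs <;> push_cast <;> ring

lemma contDiffAt_okamoto (x : ℝ) (n : ℕ) : ContDiffAt ℝ n (fun b => Okamoto b x) (1 / 2) := by
  have hd : DifferentiableOn ℂ (fun b => ∑' n, okamotoTerm x n b)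
      (Metric.ball (1 / 2 : ℂ) (1 / 4)) := by
    refine Complex.differentiableOn_tsum_of_summable_norm
      (summable_geometric_of_lt_one (by norm_num) (by norm_num : (3 / 4 : ℝ) < 1))
      (fun n => ?_) Metric.isOpen_ball (fun n w hw => norm_okamotoTerm_le x n hw)
    unfold okamotoTerm
    split_ifs <;> fun_prop
  have ha := hd.analyticAt (Metric.ball_mem_nhds _ (by norm_num))
  have hc : ContDiffAt ℂ n (fun b => ∑' n, okamotoTerm x n b) ((1 / 2 : ℝ) : ℂ) := by
    have := ha.contDiffAt (n := n)
    push_cast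
    exact this
  have := hc.real_of_complex
  refine this.congr_of_eventuallyEq (Eventually.of_forall fun b => ?_)
  simp only [Okamoto, ← ofReal_term_eq]
  rw [← Complex.ofReal_tsum, Complex.ofReal_re]

lemma summable_okamoto (x : ℝ) {b : ℝ} (hb : b ∈ Metric.ball (1 / 2 : ℝ) (1 / 4)) :
    Summable fun n => b ^ (n - lCount x n) * (1 - 2 * b) ^ lCount x n * qDig b (tDigit x n) := by
  refine Summable.of_norm_bounded
    (summable_geometric_of_lt_one (by norm_num) (by norm_num : (3 / 4 : ℝ) < 1)) fun n => ?_
  rw [← Complex.norm_real, ofReal_term_eq]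
  refine norm_okamotoTerm_le x n ?_
  rw [mem_ball_iff_norm] at hb ⊢
  rw [← Complex.norm_real] at hb
  push_cast at hb
  exact hb

section Digits

variable {d : ℕ} {s : ℝ}

lemma tDigit_zero_shift (hd : d ≤ 2) (hs : s ∈ Ico (0 : ℝ) 1) :
    tDigit ((d + s) / 3) 0 = d := by
  have hd' : (d : ℝ) ≤ 2 := by exact_mod_cast hd
  have hd0 : (0 : ℝ) ≤ d := d.cast_nonneg
  have h1 : (d + s) / 3 ≠ 1 := by linarith [hs.2]
  have h2 : ⌊(d + s) / 3⌋ = 0 := by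
    rw [Int.floor_eq_iff]; constructor <;> push_cast <;> linarith [hs.1, hs.2]
  have h3 : ⌊(d : ℝ) + s⌋ = d := by
    rw [Int.floor_eq_iff]; constructor <;> push_cast <;> linarith [hs.1, hs.2]
  rw [tDigit, if_neg h1, zero_add, pow_one, pow_zero, one_mul, mul_div_cancel₀ _ (by norm_num),
    h2, h3]
  simp

lemma floor_pow_mul_shift (d m : ℕ) (s : ℝ) :
    ⌊(3 : ℝ) ^ (m + 1) * ((d + s) / 3)⌋ = 3 ^ m * d + ⌊(3 : ℝ) ^ m * s⌋ := by
  rw [← Int.floor_intCast_add]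
  congr 1
  push_cast
  ring

lemma tDigit_succ_shift (hd : d ≤ 2) (hs : s ∈ Ico (0 : ℝ) 1) (n : ℕ) :
    tDigit ((d + s) / 3) (n + 1) = tDigit s n := by
  have hd' : (d : ℝ) ≤ 2 := by exact_mod_cast hd
  have h1 : (d + s) / 3 ≠ 1 := by linarith [hs.2]
  rw [tDigit, tDigit, if_neg h1, if_neg hs.2.ne, floor_pow_mul_shift, floor_pow_mul_shift]
  congr 1
  ring

lemma lCount_succ_shift (hd : d ≤ 2) (hs : s ∈ Ico (0 : ℝ) 1) (n : ℕ) :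
    lCount ((d + s) / 3) (n + 1) = lCount s n + if d = 1 then 1 else 0 := by
  simp only [lCount, Finset.card_filter, Finset.sum_range_succ', tDigit_succ_shift hd hs,
    tDigit_zero_shift hd hs]

lemma exists_digit_shift {x : ℝ} (hx : x ∈ Ico (0 : ℝ) 1) :
    ∃ d : ℕ, d ≤ 2 ∧ ∃ s ∈ Ico (0 : ℝ) 1, x = (d + s) / 3 := by
  have h0 : 0 ≤ 3 * x := by linarith [hx.1]
  refine ⟨⌊3 * x⌋₊, ?_, 3 * x - ⌊3 * x⌋₊, ⟨?_, ?_⟩, by ring⟩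
  · rw [← Nat.lt_succ_iff, Nat.floor_lt h0]
    push_cast
    linarith [hx.2]
  · linarith [Nat.floor_le h0]
  · linarith [Nat.lt_floor_add_one (3 * x)]

end Digits

/-- The slope of the affine map giving Okamoto's function on the `d`-th third of `[0, 1]`. -/
noncomputable def wDig (b : ℝ) (d : ℕ) : ℝ := if d = 1 then 1 - 2 * b else b

section FunctionalEquation

variable {b : ℝ}

lemma okamoto_weight_succ_shift {d : ℕ} {s : ℝ} (hd : d ≤ 2) (hs : s ∈ Ico (0 : ℝ) 1) (n : ℕ) :
    b ^ (n + 1 - lCount ((d + s) / 3) (n + 1)) *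
        (1 - 2 * b) ^ lCount ((d + s) / 3) (n + 1) =
      wDig b d * (b ^ (n - lCount s n) * (1 - 2 * b) ^ lCount s n) := by
  have hl := lCount_le s n
  rw [lCount_succ_shift hd hs, wDig]
  split_ifs
  · rw [Nat.add_sub_add_right, pow_succ]; ring
  · rw [add_zero, Nat.sub_add_comm hl, pow_succ]; ring

lemma okamoto_shift_of_lt (hb : b ∈ Metric.ball (1 / 2 : ℝ) (1 / 4)) {d : ℕ} {s : ℝ}
    (hd : d ≤ 2) (hs : s ∈ Ico (0 : ℝ) 1) :
    Okamoto b ((d + s) / 3) = qDig b d + wDig b d * Okamoto b s := by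
  rw [Okamoto, (summable_okamoto _ hb).tsum_eq_zero_add, Okamoto, ← tsum_mul_left]
  congr 1
  · simp [lCount, tDigit_zero_shift hd hs]
  · congr 1 with n
    rw [okamoto_weight_succ_shift hd hs, tDigit_succ_shift hd hs, mul_assoc]

lemma okamoto_zero (b : ℝ) : Okamoto b 0 = 0 := by
  have : ∀ n, tDigit 0 n = 0 := fun n => by simp [tDigit]
  simp [Okamoto, this, qDig]

lemma abs_lt_one_of_mem_ball (hb : b ∈ Metric.ball (1 / 2 : ℝ) (1 / 4)) : |b| < 1 := by
  rw [mem_ball_iff_norm, Real.norm_eq_abs, abs_lt] at hb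
  rw [abs_lt]
  constructor <;> linarith [hb.1, hb.2]

lemma okamoto_one (hb : b ∈ Metric.ball (1 / 2 : ℝ) (1 / 4)) : Okamoto b 1 = 1 := by
  have hd : ∀ n, tDigit 1 n = 2 := fun n => by simp [tDigit]
  have hb1 := abs_lt_one_of_mem_ball hb
  simp only [Okamoto, hd, lCount, qDig]
  simp only [OfNat.ofNat_ne_one, Finset.filter_false, Finset.card_empty, tsub_zero, pow_zero,
    mul_one, OfNat.ofNat_ne_zero, if_false]
  rw [tsum_mul_right, tsum_geometric_of_abs_lt_one hb1]
  exact inv_mul_cancel₀ (by linarith [(abs_lt.1 hb1).2])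

lemma okamoto_shift (hb : b ∈ Metric.ball (1 / 2 : ℝ) (1 / 4)) {d : ℕ} {s : ℝ}
    (hd : d ≤ 2) (hs : s ∈ Icc (0 : ℝ) 1) :
    Okamoto b ((d + s) / 3) = qDig b d + wDig b d * Okamoto b s := by
  rcases hs.2.lt_or_eq with h | rfl
  · exact okamoto_shift_of_lt hb hd ⟨hs.1, h⟩
  · have h1 := okamoto_shift_of_lt hb (d := 1) (s := 0) (by norm_num) (by simp)
    have h2 := okamoto_shift_of_lt hb (d := 2) (s := 0) (by norm_num) (by simp)
    have h3 := okamoto_one hb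
    interval_cases d <;> norm_num [okamoto_zero, qDig, wDig] at h1 h2 h3 ⊢
    · rw [h1, h3, mul_one]
    · rw [h2, h3]; ring
    · rw [h3]; ring

lemma okamoto_cylinder (hb : b ∈ Metric.ball (1 / 2 : ℝ) (1 / 4)) (m : ℕ) {x s : ℝ}
    (hx : x ∈ Ico (0 : ℝ) 1) (hs : s ∈ Icc (0 : ℝ) 1) :
    Okamoto b ((⌊(3 : ℝ) ^ m * x⌋ + s) / 3 ^ m) =
      Okamoto b (⌊(3 : ℝ) ^ m * x⌋ / 3 ^ m) +
        b ^ (m - lCount x m) * (1 - 2 * b) ^ lCount x m * Okamoto b s := by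
  induction m generalizing x with
  | zero =>
    have : ⌊x⌋ = 0 := Int.floor_eq_zero_iff.2 hx
    simp [this, lCount, okamoto_zero]
  | succ m ih =>
    obtain ⟨d, hd, x, hx', rfl⟩ := exists_digit_shift hx
    have hJ0 : (0 : ℝ) ≤ ⌊(3 : ℝ) ^ m * x⌋ := by
      have : 0 ≤ ⌊(3 : ℝ) ^ m * x⌋ := Int.floor_nonneg.2 (by have := hx'.1; positivity)
      exact_mod_cast this
    have hJ1 : (⌊(3 : ℝ) ^ m * x⌋ : ℝ) + 1 ≤ 3 ^ m := by
      have : ⌊(3 : ℝ) ^ m * x⌋ < 3 ^ m := by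
        rw [Int.floor_lt]
        push_cast
        have := hx'.2
        have h3 : (0 : ℝ) < 3 ^ m := by positivity
        nlinarith
      exact_mod_cast this
    have key : ∀ t ∈ Icc (0 : ℝ) 1, Okamoto b ((⌊(3 : ℝ) ^ (m + 1) * ((d + x) / 3)⌋ + t) /
        3 ^ (m + 1)) = qDig b d + wDig b d * Okamoto b ((⌊(3 : ℝ) ^ m * x⌋ + t) / 3 ^ m) := by
      intro t ht
      rw [← okamoto_shift hb hd, floor_pow_mul_shift]
      · congr 1
        push_cast
        field_simp
        ring
      · constructor
        · have := ht.1; positivity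
        · rw [div_le_one (by positivity)]; linarith [ht.2]
    have key0 := key 0 (by simp)
    rw [add_zero, add_zero] at key0
    rw [key s hs, key0, ih hx', okamoto_weight_succ_shift hd hx']
    ring

lemma okamoto_one_sub_pow (hb : b ∈ Metric.ball (1 / 2 : ℝ) (1 / 4)) (r : ℕ) :
    Okamoto b (1 - (1 / 3) ^ r) = 1 - b ^ r := by
  induction r with
  | zero => simp [okamoto_zero]
  | succ r ih =>
    have h1 : (1 / 3 : ℝ) ^ r ≤ 1 := pow_le_one₀ (by norm_num) (by norm_num)
    have h0 : (0 : ℝ) < (1 / 3) ^ r := by positivity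
    have := okamoto_shift hb (d := 2) (s := 1 - (1 / 3) ^ r) le_rfl ⟨by linarith, by linarith⟩
    rw [ih] at this
    convert this using 1
    · congr 1; rw [pow_succ]; push_cast; ring
    · simp [qDig, wDig]; ring

end FunctionalEquation

section Derivatives

lemma iteratedDeriv_one_sub_two_mul_pow (l i : ℕ) :
    iteratedDeriv i (fun b : ℝ => (1 - 2 * b) ^ l) (1 / 2) =
      if i = l then (-2) ^ l * (l.factorial : ℝ) else 0 := by
  have h : (fun b : ℝ => (1 - 2 * b) ^ l) = fun b => (-2) ^ l * (b - 1 / 2) ^ l := by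
    ext b; rw [← mul_pow]; ring_nf
  rw [h, iteratedDeriv_const_mul_field,
    iteratedDeriv_comp_sub_const i (fun b : ℝ => b ^ l) (1 / 2)]
  simp only [sub_self]
  rw [iteratedDeriv_fun_pow_zero, Nat.cast_ite, Nat.cast_zero, mul_ite, mul_zero]

lemma iteratedDeriv_one_sub_two_mul_pow_mul (k l : ℕ) {g : ℝ → ℝ}
    (hg : ContDiffAt ℝ k g (1 / 2)) :
    iteratedDeriv k (fun b : ℝ => (1 - 2 * b) ^ l * g b) (1 / 2) =
      if l ≤ k then k.choose l * ((-2) ^ l * l.factorial) * iteratedDeriv (k - l) g (1 / 2)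
      else 0 := by
  rw [iteratedDeriv_fun_mul (by fun_prop) hg]
  simp only [iteratedDeriv_one_sub_two_mul_pow, mul_ite, ite_mul, mul_zero, zero_mul,
    Finset.sum_ite_eq', Finset.mem_range, Nat.lt_succ_iff]

lemma le_abs_iteratedDeriv_weight {k l p : ℕ} (hl : l ≤ k) (hp : k ≤ p + l) :
    (1 / 2 : ℝ) ^ (p + l) ≤
      |iteratedDeriv k (fun b : ℝ => (1 - 2 * b) ^ l * b ^ p) (1 / 2)| := by
  rw [iteratedDeriv_one_sub_two_mul_pow_mul k l (by fun_prop), if_pos hl, iteratedDeriv_pow]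
  have h1 : (1 : ℝ) ≤ k.choose l := by exact_mod_cast Nat.choose_pos hl
  have h2 : (1 : ℝ) ≤ l.factorial := by exact_mod_cast l.factorial_pos
  have h3 : (1 : ℝ) ≤ p.descFactorial (k - l) := by
    exact_mod_cast Nat.descFactorial_pos.2 (by omega)
  have h4 : (1 : ℝ) ≤ 2 ^ l := one_le_pow₀ (by norm_num)
  have h5 : (1 / 2 : ℝ) ^ (p + l) ≤ (1 / 2) ^ (p - (k - l)) :=
    pow_le_pow_of_le_one (by norm_num) (by norm_num) (by omega)
  simp only [abs_mul, abs_pow, abs_neg, Nat.abs_cast, Nat.abs_ofNat]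
  rw [abs_of_pos (by norm_num : (0 : ℝ) < 1 / 2)]
  calc (1 / 2 : ℝ) ^ (p + l) ≤ 1 * (1 * 1) * (1 * (1 / 2) ^ (p - (k - l))) := by linarith
    _ ≤ _ := by gcongr

lemma eventually_mem_ball : ∀ᶠ b in 𝓝 (1 / 2 : ℝ), b ∈ Metric.ball (1 / 2 : ℝ) (1 / 4) :=
  Metric.ball_mem_nhds _ (by norm_num)

/-- If arbitrarily short triadic intervals around `x` carry increments of Okamoto's function
vanishing to order at most `k` at `1 / 2`, then `Mfun k (1 / 2)` is not differentiable at `x`. -/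
lemma not_hasDerivAt_Mfun {k N : ℕ} {x d : ℝ}
    (h : ∀ m ≥ N, ∃ u v : ℝ, ∃ l p : ℕ, u ≤ x ∧ x ≤ v ∧ v - u = (1 / 3) ^ m ∧ p + l = m ∧ l ≤ k ∧
      ∀ b ∈ Metric.ball (1 / 2 : ℝ) (1 / 4), Okamoto b v - Okamoto b u = (1 - 2 * b) ^ l * b ^ p) :
    ¬ HasDerivAt (Mfun k (1 / 2)) d x := by
  intro hd
  obtain ⟨C, hC⟩ := hd.differentiableAt.isBigO_sub.bound
  obtain ⟨ε, hε, hball⟩ := Metric.eventually_nhds_iff.1 hC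
  have hsmall : ∀ᶠ m : ℕ in atTop, (1 / 3 : ℝ) ^ m < ε :=
    (tendsto_pow_atTop_nhds_zero_of_lt_one (by norm_num) (by norm_num)).eventually_lt_const hε
  have hlarge : ∀ᶠ m : ℕ in atTop, 2 * |C| < (3 / 2 : ℝ) ^ m :=
    (tendsto_pow_atTop_atTop_of_one_lt (by norm_num)).eventually_gt_atTop _
  obtain ⟨m, hm1, hm2, hmN, hmk⟩ :=
    (hsmall.and (hlarge.and ((eventually_ge_atTop N).and (eventually_ge_atTop k)))).exists
  obtain ⟨u, v, l, p, hu, hv, huv, hpl, hlk, hF⟩ := h m hmN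
  have hM : Mfun k (1 / 2) v - Mfun k (1 / 2) u =
      iteratedDeriv k (fun b : ℝ => (1 - 2 * b) ^ l * b ^ p) (1 / 2) := by
    rw [Mfun, Mfun, ← iteratedDeriv_fun_sub (contDiffAt_okamoto v k) (contDiffAt_okamoto u k)]
    exact Filter.EventuallyEq.iteratedDeriv_eq k (eventually_mem_ball.mono hF)
  have hlow := le_abs_iteratedDeriv_weight (p := p) hlk (by omega)
  rw [← hM, hpl] at hlow
  have hbd : ∀ y, |y - x| ≤ (1 / 3) ^ m →
      |Mfun k (1 / 2) y - Mfun k (1 / 2) x| ≤ |C| * (1 / 3) ^ m := by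
    intro y hy
    have := hball (y := y) (by rw [Real.dist_eq]; linarith)
    rw [Real.norm_eq_abs, Real.norm_eq_abs] at this
    exact this.trans (mul_le_mul (le_abs_self C) hy (abs_nonneg _) (abs_nonneg _))
  have h1 := hbd u (by rw [abs_le]; constructor <;> linarith)
  have h2 := hbd v (by rw [abs_le]; constructor <;> linarith)
  have h3 : (1 / 2 : ℝ) ^ m ≤ 2 * |C| * (1 / 3) ^ m := by
    calc (1 / 2 : ℝ) ^ m ≤ _ := hlow
      _ ≤ _ := abs_sub_le _ (Mfun k (1 / 2) x) _
      _ ≤ 2 * |C| * (1 / 3) ^ m := by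
        rw [abs_sub_comm (Mfun k (1 / 2) x)]; linarith
  have h4 : (1 / 2 : ℝ) ^ m = (3 / 2) ^ m * (1 / 3) ^ m := by rw [← mul_pow]; norm_num
  rw [h4] at h3
  exact absurd (le_of_mul_le_mul_right h3 (by positivity)) hm2.not_ge

end Derivatives

lemma hasDerivAt_Mfun_zero {k n : ℕ} {x : ℝ} (hx : x ∈ Ioo (0 : ℝ) 1)
    (hl : lCount x n = k + 1) (hn : ¬ ∃ z : ℤ, (3 : ℝ) ^ n * x = z) :
    HasDerivAt (Mfun k (1 / 2)) 0 x := by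
  set J := ⌊(3 : ℝ) ^ n * x⌋ with hJ
  have hJx : (J : ℝ) < 3 ^ n * x :=
    lt_of_le_of_ne (Int.floor_le _) fun h => hn ⟨J, h.symm⟩
  have hxJ : 3 ^ n * x < (J : ℝ) + 1 := Int.lt_floor_add_one _
  have hc : Continuous fun y : ℝ => (3 : ℝ) ^ n * y := by fun_prop
  have hev : ∀ᶠ y in 𝓝 x, Mfun k (1 / 2) y = Mfun k (1 / 2) (J / 3 ^ n) := by
    filter_upwards [hc.continuousAt.eventually_const_lt hJx,
      hc.continuousAt.eventually_lt_const hxJ] with y hy1 hy2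
    set s := (3 : ℝ) ^ n * y - J with hs
    have hy : y = (J + s) / 3 ^ n := by rw [hs]; field_simp; ring
    have hF : ∀ b ∈ Metric.ball (1 / 2 : ℝ) (1 / 4), Okamoto b y - Okamoto b (J / 3 ^ n) =
        (1 - 2 * b) ^ (k + 1) * (b ^ (n - (k + 1)) * Okamoto b s) := by
      intro b hb
      rw [hy, okamoto_cylinder hb n ⟨hx.1.le, hx.2⟩ ⟨by linarith, by linarith⟩, hl]
      ring
    rw [← sub_eq_zero, Mfun, Mfun,
      ← iteratedDeriv_fun_sub (contDiffAt_okamoto y k) (contDiffAt_okamoto _ k),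
      Filter.EventuallyEq.iteratedDeriv_eq k (eventually_mem_ball.mono hF),
      iteratedDeriv_one_sub_two_mul_pow_mul, if_neg (by omega)]
    exact ContDiffAt.mul (by fun_prop) (contDiffAt_okamoto s k)
  exact (hasDerivAt_const x _).congr_of_eventuallyEq hev

lemma not_hasDerivAt_Mfun_of_lCount_le {k : ℕ} {x d : ℝ} (hx : x ∈ Ioo (0 : ℝ) 1)
    (hl : ∀ n, lCount x n ≤ k) : ¬ HasDerivAt (Mfun k (1 / 2)) d x := by
  refine not_hasDerivAt_Mfun (N := 0) fun m _ => ⟨⌊(3 : ℝ) ^ m * x⌋ / 3 ^ m,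
    (⌊(3 : ℝ) ^ m * x⌋ + 1) / 3 ^ m, lCount x m, m - lCount x m, ?_, ?_, ?_,
    Nat.sub_add_cancel (lCount_le x m), hl m, fun b hb => ?_⟩
  · rw [div_le_iff₀' (by positivity)]
    exact Int.floor_le _
  · rw [le_div_iff₀' (by positivity)]
    exact (Int.lt_floor_add_one _).le
  · rw [one_div_pow]; ring
  · rw [okamoto_cylinder hb m ⟨hx.1.le, hx.2⟩ (by simp), okamoto_one hb]
    ring

lemma not_hasDerivAt_Mfun_of_endpoint {k n : ℕ} {x d : ℝ} (hx : x ∈ Ioo (0 : ℝ) 1)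
    (hl : lCount x n = k) (hd : tDigit x n = 1) (hz : ∃ z : ℤ, (3 : ℝ) ^ (n + 1) * x = z) :
    ¬ HasDerivAt (Mfun k (1 / 2)) d x := by
  obtain ⟨z, hz⟩ := hz
  have hx' : x ∈ Ico (0 : ℝ) 1 := ⟨hx.1.le, hx.2⟩
  have hkn : k ≤ n := hl ▸ lCount_le x n
  set J := ⌊(3 : ℝ) ^ n * x⌋ with hJ
  have hzJ : z = 3 * J + 1 := by
    rw [tDigit, if_neg hx.2.ne, hz, Int.floor_intCast] at hd
    omega
  have hxJ : x = (J + (1 / 3)) / 3 ^ n := by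
    rw [hzJ] at hz
    push_cast at hz
    rw [eq_div_iff (by positivity)]
    rw [pow_succ] at hz
    linarith
  refine not_hasDerivAt_Mfun (N := n + 1) fun m hm => ?_
  obtain ⟨r, rfl⟩ := Nat.exists_eq_add_of_le hm
  have hr1 : (1 / 3 : ℝ) ^ r ≤ 1 := pow_le_one₀ (by norm_num) (by norm_num)
  have hr0 : (0 : ℝ) < (1 / 3) ^ r := by positivity
  refine ⟨x - (1 / 3) ^ (n + 1 + r), x, k, n - k + r + 1, by simp, le_rfl, by ring,
    by omega, le_rfl, fun b hb => ?_⟩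
  have hu : x - (1 / 3) ^ (n + 1 + r) = (J + (1 - (1 / 3) ^ r) / 3) / 3 ^ n := by
    rw [hxJ, pow_add, pow_succ, one_div_pow 3 n]; ring
  have h1 := okamoto_shift hb (d := 0) (s := 1) (by norm_num) (by simp)
  have h2 := okamoto_shift hb (d := 0) (s := 1 - (1 / 3) ^ r) (by norm_num)
    ⟨by linarith, by linarith⟩
  rw [okamoto_one hb] at h1
  rw [okamoto_one_sub_pow hb] at h2
  simp only [Nat.cast_zero, zero_add, qDig, wDig, if_true, zero_ne_one, if_false] at h1 h2
  have h3 := okamoto_cylinder hb n hx' (s := 1 / 3) ⟨by norm_num, by norm_num⟩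
  have h4 := okamoto_cylinder hb n hx' (s := (1 - (1 / 3) ^ r) / 3) ⟨by linarith, by linarith⟩
  rw [← hJ, hl, h1, ← hxJ] at h3
  rw [← hJ, hl, h2, ← hu] at h4
  rw [h3, h4, pow_succ, pow_add]
  ring

/-- for `a = 1/2` and `k ≥ 1`, `M_{k,1/2}` has a finite derivative at
`x ∈ (0,1)` iff there is `n ∈ ℕ` with `l_n(x) = k+1` and `3^n x ∉ ℤ`; in that case the
derivative is `0`. -/
theorem stmt6 (k : ℕ) (hk : 1 ≤ k) (x : ℝ) (hx : x ∈ Set.Ioo (0:ℝ) 1) :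
    ((∃ d : ℝ, HasDerivAt (Mfun k (1/2)) d x) ↔
      ∃ n : ℕ, lCount x n = k + 1 ∧ ¬ ∃ z : ℤ, (3:ℝ) ^ n * x = (z : ℝ)) ∧
    ∀ d : ℝ, HasDerivAt (Mfun k (1/2)) d x → d = 0 := by
  have hpos : ∀ n, lCount x n = k + 1 → (¬ ∃ z : ℤ, (3 : ℝ) ^ n * x = z) →
      HasDerivAt (Mfun k (1 / 2)) 0 x := fun n => hasDerivAt_Mfun_zero hx
  have hex : ∀ d, HasDerivAt (Mfun k (1 / 2)) d x →
      ∃ n : ℕ, lCount x n = k + 1 ∧ ¬ ∃ z : ℤ, (3 : ℝ) ^ n * x = z := by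
    intro d hd
    by_contra! hcon
    by_cases hle : ∀ n, lCount x n ≤ k
    · exact not_hasDerivAt_Mfun_of_lCount_le hx hle hd
    · push Not at hle
      obtain ⟨n, hn⟩ : ∃ n, lCount x n ≤ k ∧ k < lCount x (n + 1) := by
        by_contra! h
        obtain ⟨n, hn⟩ := hle
        exact hn.not_ge (Nat.rec (by simp [lCount]) h n)
      have hs := lCount_succ x n
      have hdig : tDigit x n = 1 := by
        by_contra hne
        rw [if_neg hne] at hs
        omega
      rw [if_pos hdig] at hs
      exact not_hasDerivAt_Mfun_of_endpoint hx (by omega) hdig (hcon (n + 1) (by omega)) hd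
  refine ⟨⟨fun ⟨d, hd⟩ => hex d hd, fun ⟨n, h1, h2⟩ => ⟨0, hpos n h1 h2⟩⟩, fun d hd => ?_⟩
  obtain ⟨n, h1, h2⟩ := hex d hd
  exact hd.unique (hpos n h1 h2)
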